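/- arXiv:2505.10352 — 3 statements merged into one kernel-verified Lean document; each statement's English description precedes it below -/
import Mathlib

section
/- Let C, D be positive natural numbers, let q, k : Fin C → ℝ be nonzero vectors, and let δ > 0. Let A be a random D × C matrix whose entries are independent standard Gaussian random variables, i.e., A is distributed according to the product measure ⨂_{i ∈ Fin D, j ∈ Fin C} N(0,1) on (Fin D → Fin C → ℝ). Define the binary embeddings q_s, k_s : Fin D → ({0,1} ⊆ ℝ) by q_s(i) = 1 if ∑_j A i j * q j > 0 and q_s(i) = 0 otherwise, and similarly for k_s with k in place of q. Then the probability, with respect to the law of A, of the event { |f_H(q_s, k_s) − g(f_C(q, k))| ≤ δ } is at least 1 − 2·exp(−δ²·D). -/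
open MeasureTheory ProbabilityTheory

/-- Normalized Hamming similarity between two (binary) vectors in `Fin D → ℝ`. -/
noncomputable def hammingSim {D : ℕ} (b b' : Fin D → ℝ) : ℝ :=
  1 - (1 / (D : ℝ)) * ((Finset.univ.filter (fun i => b i ≠ b' i)).card : ℝ)

/-- Cosine similarity between two vectors in `Fin C → ℝ`, with the Euclidean norm. -/
noncomputable def cosSim {C : ℕ} (x y : Fin C → ℝ) : ℝ :=
  (∑ j, x j * y j) / (Real.sqrt (∑ j, x j ^ 2) * Real.sqrt (∑ j, y j ^ 2))

/-- The monotone function `g x = 1 - (1/π) arccos x`. -/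
noncomputable def g (x : ℝ) : ℝ := 1 - (1 / Real.pi) * Real.arccos x

/-- Binary embedding of `q` by the random matrix `A`:
`(binEmbed A q) i = 1` if `∑ j, A i j * q j > 0` and `0` otherwise. -/
noncomputable def binEmbed {D C : ℕ} (A : Fin D → Fin C → ℝ) (q : Fin C → ℝ) :
    Fin D → ℝ :=
  fun i => if 0 < ∑ j, A i j * q j then 1 else 0

open scoped RealInnerProductSpace

lemma map_inner_prod_stdGaussian {E : Type*} [NormedAddCommGroup E] [InnerProductSpace ℝ E]
    [FiniteDimensional ℝ E] [MeasurableSpace E] [BorelSpace E] {x y : E} {θ : ℝ}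
    (hx : ‖x‖ = 1) (hy : ‖y‖ = 1) (hxy : ⟪x, y⟫ = Real.cos θ) :
    (stdGaussian E).map (fun z ↦ (⟪x, z⟫, ⟪y, z⟫)) =
      ((gaussianReal 0 1).prod (gaussianReal 0 1)).map
        (fun z ↦ (z.1, Real.cos θ * z.1 + Real.sin θ * z.2)) := by
  refine Measure.ext_of_charFunDual ?_
  ext L
  have hL (a b : ℝ) : L (a, b) = L (1, 0) * a + L (0, 1) * b := by
    rw [show ((a, b) : ℝ × ℝ) = a • (1, 0) + b • (0, 1) by simp, map_add, map_smul, map_smul]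
    simp [mul_comm]
  set s := L (1, 0)
  set t := L (0, 1)
  have h₁ : charFunDual ((stdGaussian E).map (fun z ↦ (⟪x, z⟫, ⟪y, z⟫))) L =
      charFun (stdGaussian E) (s • x + t • y) := by
    rw [charFunDual_apply, charFun_apply, integral_map (by fun_prop) (by fun_prop)]
    simp_rw [hL, inner_add_right, inner_smul_right, real_inner_comm]
  have h₂ : charFunDual (((gaussianReal 0 1).prod (gaussianReal 0 1)).map
        (fun z ↦ (z.1, Real.cos θ * z.1 + Real.sin θ * z.2))) L =
      charFun (gaussianReal 0 1) (s + t * Real.cos θ) *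
        charFun (gaussianReal 0 1) (t * Real.sin θ) := by
    rw [charFunDual_apply, charFun_apply, charFun_apply,
      integral_map (by fun_prop) (by fun_prop), ← integral_prod_mul]
    simp_rw [hL, ← Complex.exp_add]
    congr! 3
    simp
    ring
  have hn : ‖s • x + t • y‖ ^ 2 = (s + t * Real.cos θ) ^ 2 + (t * Real.sin θ) ^ 2 := by
    rw [norm_add_sq_real, norm_smul, norm_smul, real_inner_smul_left, real_inner_smul_right, hxy,
      hx, hy]
    simp
    linear_combination (-t ^ 2) * Real.sin_sq_add_cos_sq θ
  rw [h₁, h₂, charFun_stdGaussian, charFun_gaussianReal, charFun_gaussianReal, ← Complex.exp_add,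
    ← Complex.ofReal_pow, hn]
  congr 1
  push_cast
  simp
  ring

lemma exists_gaussianReal_prod_eq_mul_volume :
    ∃ c, ∀ (S : Set (ℝ × ℝ)) (T : Set ℝ), MeasurableSet S → MeasurableSet T →
      T ⊆ Set.Ioo (-Real.pi) Real.pi →
      (∀ r φ, 0 < r → φ ∈ Set.Ioo (-Real.pi) Real.pi →
        ((r * Real.cos φ, r * Real.sin φ) ∈ S ↔ φ ∈ T)) →
      ((gaussianReal 0 1).prod (gaussianReal 0 1)) S = c * volume T := by
  set G : ℝ → ENNReal := fun r ↦ ENNReal.ofReal r * (gaussianPDF 0 1 r * gaussianPDF 0 1 0) with hG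
  have hGm : Measurable G := by
    have := measurable_gaussianPDF 0 1
    fun_prop
  refine ⟨∫⁻ r in Set.Ioi 0, G r, fun S T hS hT hTs hST ↦ ?_⟩
  have hpdf (r φ : ℝ) : gaussianPDF 0 1 (r * Real.cos φ) * gaussianPDF 0 1 (r * Real.sin φ) =
      gaussianPDF 0 1 r * gaussianPDF 0 1 0 := by
    simp only [gaussianPDF, gaussianPDFReal]
    rw [← ENNReal.ofReal_mul (by positivity), ← ENNReal.ofReal_mul (by positivity),
      mul_mul_mul_comm _ (Real.exp _), mul_mul_mul_comm _ (Real.exp _), ← Real.exp_add, ← Real.exp_add]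
    congr 3
    simp
    linear_combination (-r ^ 2 / 2) * Real.sin_sq_add_cos_sq φ
  rw [gaussianReal_of_var_ne_zero 0 one_ne_zero,
    prod_withDensity (measurable_gaussianPDF 0 1) (measurable_gaussianPDF 0 1),
    withDensity_apply _ hS, ← lintegral_indicator hS, ← Measure.volume_eq_prod,
    ← lintegral_comp_polarCoord_symm]
  calc
    _ = ∫⁻ p in polarCoord.target, G p.1 * T.indicator 1 p.2 := by
      refine setLIntegral_congr_fun polarCoord.open_target.measurableSet fun p hp ↦ ?_
      have h := hST p.1 p.2 hp.1 hp.2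
      by_cases hpT : p.2 ∈ T
      · simp [polarCoord, hG, h.2 hpT, hpT, hpdf]
      · simp [polarCoord, mt h.1 hpT, hpT]
    _ = _ := by
      rw [show polarCoord.target = Set.Ioi (0 : ℝ) ×ˢ Set.Ioo (-Real.pi) Real.pi from rfl,
        Measure.volume_eq_prod, ← Measure.prod_restrict, lintegral_prod_mul hGm.aemeasurable
          (measurable_one.indicator hT).aemeasurable, lintegral_indicator_one hT,
        Measure.restrict_apply hT, Set.inter_eq_left.2 hTs]

/-- The mass of a cone under the standard planar Gaussian is proportional to its angle. -/
lemma gaussianReal_prod_cone {S : Set (ℝ × ℝ)} {T : Set ℝ} (hS : MeasurableSet S)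
    (hT : MeasurableSet T) (hTs : T ⊆ Set.Ioo (-Real.pi) Real.pi)
    (hST : ∀ r φ, 0 < r → φ ∈ Set.Ioo (-Real.pi) Real.pi →
      ((r * Real.cos φ, r * Real.sin φ) ∈ S ↔ φ ∈ T)) :
    ((gaussianReal 0 1).prod (gaussianReal 0 1)) S =
      volume T / ENNReal.ofReal (2 * Real.pi) := by
  obtain ⟨c, hc⟩ := exists_gaussianReal_prod_eq_mul_volume
  have h := hc Set.univ (Set.Ioo (-Real.pi) Real.pi) .univ measurableSet_Ioo subset_rfl
    (fun r φ _ hφ ↦ by simp [hφ.1, hφ.2])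
  rw [measure_univ, Real.volume_Ioo, sub_neg_eq_add, ← two_mul] at h
  rw [hc S T hS hT hTs hST, ENNReal.eq_inv_of_mul_eq_one_left h.symm, mul_comm, div_eq_mul_inv]

lemma gaussianReal_prod_wedge {θ : ℝ} (h0 : 0 ≤ θ) (hπ : θ ≤ Real.pi) :
    ((gaussianReal 0 1).prod (gaussianReal 0 1))
      {z | 0 < z.1 ∧ Real.cos θ * z.1 + Real.sin θ * z.2 ≤ 0} =
        ENNReal.ofReal (θ / (2 * Real.pi)) := by
  have hp := Real.pi_pos
  have hm : MeasurableSet {z : ℝ × ℝ | 0 < z.1 ∧ Real.cos θ * z.1 + Real.sin θ * z.2 ≤ 0} := by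
    measurability
  have hvol : volume (Set.Ioc (-(Real.pi / 2)) (θ - Real.pi / 2) ∩ Set.Iio (Real.pi / 2)) =
      ENNReal.ofReal θ := by
    have hθ : θ - Real.pi / 2 - -(Real.pi / 2) = θ := by ring
    refine le_antisymm ((measure_mono Set.inter_subset_left).trans_eq ?_) ?_
    · rw [Real.volume_Ioc, hθ]
    · rw [← hθ, ← Real.volume_Ioo, hθ]
      exact measure_mono fun φ hφ ↦ ⟨⟨hφ.1, hφ.2.le⟩, hφ.2.trans_le (by linarith)⟩
  rw [gaussianReal_prod_cone hm (measurableSet_Ioc.inter measurableSet_Iio), hvol,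
    ← ENNReal.ofReal_div_of_pos (by positivity)]
  · rintro φ ⟨⟨h₁, h₂⟩, h₃⟩
    have h₃ := Set.mem_Iio.1 h₃
    constructor <;> linarith
  · intro r φ hr hφ
    have hadd : Real.cos θ * (r * Real.cos φ) + Real.sin θ * (r * Real.sin φ) =
        r * Real.cos (φ - θ) := by rw [Real.cos_sub]; ring
    have hmul : r * Real.cos (φ - θ) ≤ 0 ↔ Real.cos (φ - θ) ≤ 0 :=
      ⟨fun h ↦ nonpos_of_mul_nonpos_right h hr, mul_nonpos_of_nonneg_of_nonpos hr.le⟩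
    simp only [Set.mem_ofPred_eq, hadd, mul_pos_iff_of_pos_left hr, hmul, Set.mem_inter_iff,
      Set.mem_Ioc, Set.mem_Iio]
    constructor
    · rintro ⟨hc, hs⟩
      have ha : -(Real.pi / 2) < φ := by
        by_contra! h
        have := Real.cos_nonpos_of_pi_div_two_le_of_le (x := -φ) (by linarith) (by linarith [hφ.1])
        rw [Real.cos_neg] at this
        linarith
      have hb : φ < Real.pi / 2 := by
        by_contra! h
        have := Real.cos_nonpos_of_pi_div_two_le_of_le h (by linarith [hφ.2])
        linarith
      refine ⟨⟨ha, ?_⟩, hb⟩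
      by_contra! h
      have := Real.cos_pos_of_mem_Ioo (x := φ - θ) ⟨by linarith, by linarith⟩
      linarith
    · rintro ⟨⟨ha, hb⟩, hb'⟩
      refine ⟨Real.cos_pos_of_mem_Ioo ⟨ha, hb'⟩, ?_⟩
      rw [← Real.cos_neg]
      exact Real.cos_nonpos_of_pi_div_two_le_of_le (by linarith) (by linarith)

lemma stdGaussian_inner_pos_inner_nonpos {E : Type*} [NormedAddCommGroup E]
    [InnerProductSpace ℝ E] [FiniteDimensional ℝ E] [MeasurableSpace E] [BorelSpace E]
    {x y : E} (hx : x ≠ 0) (hy : y ≠ 0) :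
    stdGaussian E {z | 0 < ⟪x, z⟫ ∧ ⟪y, z⟫ ≤ 0} =
      ENNReal.ofReal (InnerProductGeometry.angle x y / (2 * Real.pi)) := by
  have hx' := norm_pos_iff.2 hx
  have hy' := norm_pos_iff.2 hy
  have hinner : ⟪‖x‖⁻¹ • x, ‖y‖⁻¹ • y⟫ = Real.cos (InnerProductGeometry.angle x y) := by
    rw [InnerProductGeometry.cos_angle, real_inner_smul_left, real_inner_smul_right]
    field_simp
  have hset : {z : E | 0 < ⟪x, z⟫ ∧ ⟪y, z⟫ ≤ 0} =
      (fun z ↦ (⟪‖x‖⁻¹ • x, z⟫, ⟪‖y‖⁻¹ • y, z⟫)) ⁻¹' {p | 0 < p.1 ∧ p.2 ≤ 0} := by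
    ext z
    simp [real_inner_smul_left, hx', mul_nonpos_iff, hy'.le, hy'.not_ge]
  have hm : MeasurableSet {p : ℝ × ℝ | 0 < p.1 ∧ p.2 ≤ 0} := by measurability
  rw [hset, ← Measure.map_apply (by fun_prop) hm, map_inner_prod_stdGaussian
    (by simp [norm_smul, hx]) (by simp [norm_smul, hy]) hinner,
    Measure.map_apply (by fun_prop) hm]
  exact gaussianReal_prod_wedge (InnerProductGeometry.angle_nonneg x y)
    (InnerProductGeometry.angle_le_pi x y)

lemma pi_gaussianReal_pos_nonpos {C : ℕ} {q k : Fin C → ℝ} (hq : q ≠ 0) (hk : k ≠ 0) :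
    (Measure.pi fun _ : Fin C ↦ gaussianReal 0 1) {a | 0 < ∑ j, a j * q j ∧ ∑ j, a j * k j ≤ 0} =
      ENNReal.ofReal (Real.arccos (cosSim q k) / (2 * Real.pi)) := by
  have h := stdGaussian_inner_pos_inner_nonpos (E := EuclideanSpace ℝ (Fin C))
    (x := WithLp.toLp 2 q) (y := WithLp.toLp 2 k) (by simpa using hq) (by simpa using hk)
  have hm : MeasurableSet {z : EuclideanSpace ℝ (Fin C) |
      0 < ⟪WithLp.toLp 2 q, z⟫ ∧ ⟪WithLp.toLp 2 k, z⟫ ≤ 0} := by measurability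
  rw [← map_pi_eq_stdGaussian, Measure.map_apply (by fun_prop) hm] at h
  convert h using 2
  · ext a
    simp [PiLp.inner_apply]
  · simp [InnerProductGeometry.angle, cosSim, PiLp.inner_apply, EuclideanSpace.norm_eq, mul_comm]

lemma cosSim_comm {C : ℕ} (q k : Fin C → ℝ) : cosSim q k = cosSim k q := by
  simp only [cosSim, mul_comm]

/-- The sign patterns of the projections of a standard Gaussian vector on `q` and `k` differ with
probability `θ / π`, where `θ` is the angle between `q` and `k`. -/
lemma pi_gaussianReal_real_sign_ne {C : ℕ} {q k : Fin C → ℝ} (hq : q ≠ 0) (hk : k ≠ 0) :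
    (Measure.pi fun _ : Fin C ↦ gaussianReal 0 1).real
      {a | ¬ (0 < ∑ j, a j * q j ↔ 0 < ∑ j, a j * k j)} = Real.arccos (cosSim q k) / Real.pi := by
  have hset : {a : Fin C → ℝ | ¬ (0 < ∑ j, a j * q j ↔ 0 < ∑ j, a j * k j)} =
      {a | 0 < ∑ j, a j * q j ∧ ∑ j, a j * k j ≤ 0} ∪
        {a | 0 < ∑ j, a j * k j ∧ ∑ j, a j * q j ≤ 0} := by
    ext a
    simp only [Set.mem_ofPred_eq, Set.mem_union, ← not_lt]
    tauto
  have hm : MeasurableSet {a : Fin C → ℝ | 0 < ∑ j, a j * k j ∧ ∑ j, a j * q j ≤ 0} := by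
    measurability
  have hd : Disjoint {a : Fin C → ℝ | 0 < ∑ j, a j * q j ∧ ∑ j, a j * k j ≤ 0}
      {a | 0 < ∑ j, a j * k j ∧ ∑ j, a j * q j ≤ 0} :=
    Set.disjoint_left.2 fun a h h' ↦ h'.2.not_gt h.1
  have hnn := Real.arccos_nonneg (cosSim q k)
  have hp := Real.pi_pos
  rw [hset, measureReal_union hd hm, measureReal_def, measureReal_def,
    pi_gaussianReal_pos_nonpos hq hk, pi_gaussianReal_pos_nonpos hk hq, cosSim_comm k q,
    ENNReal.toReal_ofReal (by positivity)]
  field_simp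
  ring

/-- Two-sided Hoeffding inequality for the empirical frequency of an event under a product
measure. -/
lemma measureReal_pi_abs_frequency_sub_gt_le {D : ℕ} (hD : 0 < D) {Ω : Type*} [MeasurableSpace Ω]
    (μ : Measure Ω) [IsProbabilityMeasure μ] {S : Set Ω} (hS : MeasurableSet S) {δ : ℝ}
    (hδ : 0 ≤ δ) :
    (Measure.pi fun _ : Fin D ↦ μ).real
      {A | δ < |(1 / (D : ℝ)) * ∑ i, S.indicator (fun _ ↦ (1 : ℝ)) (A i) - μ.real S|} ≤
        2 * Real.exp (-2 * δ ^ 2 * D) := by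
  have hD' : (0 : ℝ) < D := by exact_mod_cast hD
  set Y : Ω → ℝ := fun a ↦ S.indicator (fun _ ↦ (1 : ℝ)) a - μ.real S with hY
  have hYm : Measurable Y := (measurable_const.indicator hS).sub_const _
  have hsub : HasSubgaussianMGF Y ((‖(1 : ℝ) - 0‖₊ / 2) ^ 2) μ := by
    have h := hasSubgaussianMGF_of_mem_Icc (μ := μ) (X := S.indicator (fun _ ↦ (1 : ℝ)))
      (a := 0) (b := 1) (measurable_const.indicator hS).aemeasurable
      (ae_of_all _ fun a ↦ by by_cases ha : a ∈ S <;> simp [ha])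
    rwa [integral_indicator_const _ hS, smul_eq_mul, mul_one] at h
  have tail (Z : Ω → ℝ) (hZm : Measurable Z)
      (hZ : HasSubgaussianMGF Z ((‖(1 : ℝ) - 0‖₊ / 2) ^ 2) μ) :
      (Measure.pi fun _ : Fin D ↦ μ).real {A | D * δ ≤ ∑ i, Z (A i)} ≤
        Real.exp (-2 * δ ^ 2 * D) := by
    have h := HasSubgaussianMGF.measure_sum_ge_le_of_iIndepFun (μ := Measure.pi fun _ : Fin D ↦ μ)
      (X := fun i A ↦ Z (A i)) (iIndepFun_pi fun _ ↦ hZm.aemeasurable)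
      (c := fun _ ↦ (‖(1 : ℝ) - 0‖₊ / 2) ^ 2) (s := Finset.univ) (fun i _ ↦ by
        refine HasSubgaussianMGF.of_map (Y := fun A : Fin D → Ω ↦ A i) (X := Z)
          (measurable_pi_apply i).aemeasurable ?_
        rwa [(measurePreserving_eval (fun _ : Fin D ↦ μ) i).map_eq])
      (ε := D * δ) (by positivity)
    refine h.trans_eq ?_
    congr 1
    simp
    field_simp
  calc
    _ ≤ (Measure.pi fun _ : Fin D ↦ μ).real
        ({A | D * δ ≤ ∑ i, Y (A i)} ∪ {A | D * δ ≤ ∑ i, (-Y) (A i)}) := by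
      refine measureReal_mono fun A hA ↦ ?_
      have hsum : ∑ i, Y (A i) =
          D * ((1 / (D : ℝ)) * ∑ i, S.indicator (fun _ ↦ (1 : ℝ)) (A i) - μ.real S) := by
        simp [hY, Finset.sum_sub_distrib]
        field_simp
      simp only [Set.mem_union, Set.mem_ofPred_eq, Pi.neg_apply, Finset.sum_neg_distrib, hsum,
        ← mul_neg, mul_le_mul_iff_right₀ hD']
      exact (lt_abs.1 hA).imp le_of_lt le_of_lt
    _ ≤ _ := (measureReal_union_le _ _).trans (by
      rw [two_mul]
      exact add_le_add (tail Y hYm hsub) (tail (-Y) hYm.neg hsub.neg))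

theorem stmt_0 (C D : ℕ) (hC : 0 < C) (hD : 0 < D)
    (q k : Fin C → ℝ) (hq : q ≠ 0) (hk : k ≠ 0) (δ : ℝ) (hδ : 0 < δ) :
    (Measure.pi fun _ : Fin D => Measure.pi fun _ : Fin C => gaussianReal 0 1)
        {A : Fin D → Fin C → ℝ |
          |hammingSim (binEmbed A q) (binEmbed A k) - g (cosSim q k)| ≤ δ}
      ≥ ENNReal.ofReal (1 - 2 * Real.exp (-δ ^ 2 * D)) := by
  set S : Set (Fin C → ℝ) := {a | ¬ (0 < ∑ j, a j * q j ↔ 0 < ∑ j, a j * k j)} with hS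
  have hSm : MeasurableSet S := by
    have h (v : Fin C → ℝ) : MeasurableSet {a : Fin C → ℝ | 0 < ∑ j, a j * v j} := by
      measurability
    exact MeasurableSet.compl ((h q).iff (h k))
  have hfreq (A : Fin D → Fin C → ℝ) :
      |hammingSim (binEmbed A q) (binEmbed A k) - g (cosSim q k)| =
        |(1 / (D : ℝ)) * ∑ i, S.indicator (fun _ ↦ (1 : ℝ)) (A i) -
          (Measure.pi fun _ : Fin C ↦ gaussianReal 0 1).real S| := by
    have hcard : ((Finset.univ.filter fun i ↦ binEmbed A q i ≠ binEmbed A k i).card : ℝ) =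
        ∑ i, S.indicator (fun _ ↦ (1 : ℝ)) (A i) := by
      rw [Finset.card_filter]
      push_cast
      refine Finset.sum_congr rfl fun i _ ↦ ?_
      by_cases h₁ : 0 < ∑ j, A i j * q j <;> by_cases h₂ : 0 < ∑ j, A i j * k j <;>
        simp [binEmbed, Set.indicator, hS, h₁, h₂]
    rw [pi_gaussianReal_real_sign_ne hq hk, hammingSim, g, hcard, ← abs_neg]
    congr 1
    ring
  have htail := measureReal_pi_abs_frequency_sub_gt_le hD
    (Measure.pi fun _ : Fin C ↦ gaussianReal 0 1) hSm hδ.le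
  have hexp : Real.exp (-2 * δ ^ 2 * D) ≤ Real.exp (-δ ^ 2 * D) := by
    refine Real.exp_le_exp.2 ?_
    have : 0 ≤ δ ^ 2 * (D : ℝ) := by positivity
    linarith
  simp_rw [hfreq]
  have hm : MeasurableSet {A : Fin D → Fin C → ℝ |
      δ < |(1 / (D : ℝ)) * ∑ i, S.indicator (fun _ ↦ (1 : ℝ)) (A i) -
          (Measure.pi fun _ : Fin C ↦ gaussianReal 0 1).real S|} := by
    have : Measurable (S.indicator fun _ ↦ (1 : ℝ)) := measurable_const.indicator hSm
    exact measurableSet_lt (by fun_prop) (by fun_prop)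
  rw [ge_iff_le, ENNReal.ofReal_le_iff_le_toReal (measure_ne_top _ _), ← measureReal_def]
  have hcompl := probReal_compl_eq_one_sub
    (μ := Measure.pi fun _ : Fin D ↦ Measure.pi fun _ : Fin C ↦ gaussianReal 0 1) hm
  simp only [Set.compl_ofPred, not_lt] at hcompl
  rw [hcompl]
  linarith
end

section
/- Let C, D be positive natural numbers, let q, k : Fin C → ℝ be nonzero vectors, and let δ > 0. Let A be a random D × C matrix whose entries are independent standard Gaussian random variables, i.e., A is distributed according to the product measure ⨂_{i ∈ Fin D, j ∈ Fin C} N(0,1) on (Fin D → Fin C → ℝ). Define the binary embeddings q_s, k_s : Fin D → ({0,1} ⊆ ℝ) by q_s(i) = 1 if ∑_j A i j * q j > 0 and q_s(i) = 0 otherwise, and similarly for k_s with k in place of q. Then the probability, with respect to the law of A, of the event { |d_H(q_s, k_s) − d_C(q, k)| ≤ δ } is at least 1 − 2·exp(−δ²·D). -/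
open MeasureTheory ProbabilityTheory

/-- Normalized Hamming distance between two (binary) vectors in `Fin D → ℝ`. -/
noncomputable def normHamDist {D : ℕ} (b b' : Fin D → ℝ) : ℝ :=
  (1 / (D : ℝ)) * ((Finset.univ.filter (fun i => b i ≠ b' i)).card : ℝ)

/-- Cosine distance between two vectors in `Fin C → ℝ`, with the Euclidean norm. -/
noncomputable def cosDist {C : ℕ} (x y : Fin C → ℝ) : ℝ :=
  (1 / Real.pi) *
    Real.arccos ((∑ j, x j * y j) / (Real.sqrt (∑ j, x j ^ 2) * Real.sqrt (∑ j, y j ^ 2)))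

lemma charFunDual_gaussianReal_zero_one (L : StrongDual ℝ ℝ) :
    charFunDual (gaussianReal 0 1) L = Complex.exp (-((L 1 : ℝ) : ℂ) ^ 2 / 2) := by
  have hL : L = (L 1) • ContinuousLinearMap.id ℝ ℝ := by ext; simp
  have h := charFun_map_eq_charFunDual_smul (μ := gaussianReal 0 1)
    (ContinuousLinearMap.id ℝ ℝ) (L 1)
  rw [← hL] at h
  rw [← h]
  have hid : ⇑(ContinuousLinearMap.id ℝ ℝ) = id := rfl
  rw [hid, Measure.map_id, charFun_gaussianReal]
  congr 1
  push_cast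
  ring

/-- Two correlated linear forms of a standard Gaussian vector have the law of
`(x, cos θ x + sin θ y)` for independent standard Gaussians `x, y`. -/
lemma map_pi_gaussianReal_eq_map_prod {ι : Type*} [Fintype ι] (q k : ι → ℝ) (θ : ℝ)
    (hq : ∑ j, q j ^ 2 = 1) (hk : ∑ j, k j ^ 2 = 1) (hqk : ∑ j, q j * k j = Real.cos θ) :
    (Measure.pi fun _ : ι => gaussianReal 0 1).map
        (fun a => (∑ j, a j * q j, ∑ j, a j * k j)) =
      ((gaussianReal 0 1).prod (gaussianReal 0 1)).map
        (fun z => (z.1, Real.cos θ * z.1 + Real.sin θ * z.2)) := by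
  classical
  let f : (ι → ℝ) →L[ℝ] ℝ × ℝ :=
    (∑ j, q j • ContinuousLinearMap.proj (R := ℝ) (φ := fun _ : ι => ℝ) j).prod
      (∑ j, k j • ContinuousLinearMap.proj (R := ℝ) (φ := fun _ : ι => ℝ) j)
  let g : ℝ × ℝ →L[ℝ] ℝ × ℝ :=
    (ContinuousLinearMap.fst ℝ ℝ ℝ).prod
      (Real.cos θ • ContinuousLinearMap.fst ℝ ℝ ℝ + Real.sin θ • ContinuousLinearMap.snd ℝ ℝ ℝ)
  have hf : (fun a : ι → ℝ => (∑ j, a j * q j, ∑ j, a j * k j)) = f := by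
    ext a <;> simp [f, mul_comm]
  have hg : (fun z : ℝ × ℝ => (z.1, Real.cos θ * z.1 + Real.sin θ * z.2)) = g := by
    ext z <;> simp [g]
  rw [hf, hg]
  have := Measure.isProbabilityMeasure_map (μ := Measure.pi fun _ : ι => gaussianReal 0 1)
    f.continuous.aemeasurable
  have := Measure.isProbabilityMeasure_map (μ := (gaussianReal 0 1).prod (gaussianReal 0 1))
    g.continuous.aemeasurable
  apply Measure.ext_of_charFunDual
  ext L
  have hL : ∀ x y : ℝ, L (x, y) = x * L (1, 0) + y * L (0, 1) := fun x y => by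
    have : ((x, y) : ℝ × ℝ) = x • ((1, 0) : ℝ × ℝ) + y • ((0, 1) : ℝ × ℝ) := by simp
    rw [this, map_add, map_smul, map_smul, smul_eq_mul, smul_eq_mul]
  rw [charFunDual_map, charFunDual_map, charFunDual_pi, charFunDual_prod]
  simp only [charFunDual_gaussianReal_zero_one, ← Complex.exp_sum, ← Complex.exp_add]
  have h1 : ∀ j, (L.comp f).comp (ContinuousLinearMap.single ℝ (fun _ : ι => ℝ) j) 1 =
      q j * L (1, 0) + k j * L (0, 1) := fun j => by
    rw [← hL]
    simp [f, Pi.single_apply]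
  have h2 : (L.comp g).comp (ContinuousLinearMap.inl ℝ ℝ ℝ) 1 =
      L (1, 0) + Real.cos θ * L (0, 1) := by
    have := hL 1 (Real.cos θ)
    simpa [g] using this
  have h3 : (L.comp g).comp (ContinuousLinearMap.inr ℝ ℝ ℝ) 1 = Real.sin θ * L (0, 1) := by
    have := hL 0 (Real.sin θ)
    simpa [g] using this
  simp only [h1, h2, h3]
  congr 1
  norm_cast
  rw [← Finset.sum_div, ← add_div, Finset.sum_neg_distrib]
  congr 1
  have : ∑ j, (q j * L (1, 0) + k j * L (0, 1)) ^ 2 =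
      L (1, 0) ^ 2 * (∑ j, q j ^ 2) + L (0, 1) ^ 2 * (∑ j, k j ^ 2) +
        2 * L (1, 0) * L (0, 1) * ∑ j, q j * k j := by
    simp only [Finset.mul_sum, ← Finset.sum_add_distrib]
    exact Finset.sum_congr rfl fun j _ => by ring
  rw [this, hq, hk, hqk]
  linear_combination L (0, 1) ^ 2 * (Real.sin_sq_add_cos_sq θ)

/-- The angular coordinate of a planar standard Gaussian is uniform. -/
lemma gaussianReal_prod_apply_of_polar {S : Set (ℝ × ℝ)} {T : Set ℝ} (hS : MeasurableSet S)
    (hT : MeasurableSet T)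
    (h : ∀ r > 0, ∀ φ ∈ Set.Ioo (-Real.pi) Real.pi,
      (r * Real.cos φ, r * Real.sin φ) ∈ S ↔ φ ∈ T) :
    ((gaussianReal 0 1).prod (gaussianReal 0 1)) S =
      volume (T ∩ Set.Ioo (-Real.pi) Real.pi) / ENNReal.ofReal (2 * Real.pi) := by
  let ρ : ℝ → ENNReal := fun r =>
    ENNReal.ofReal r * ENNReal.ofReal ((2 * Real.pi)⁻¹ * Real.exp (-r ^ 2 / 2))
  have hρ : Measurable ρ := by fun_prop
  have key : ∀ {S : Set (ℝ × ℝ)} {T : Set ℝ}, MeasurableSet S → MeasurableSet T →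
      (∀ r > 0, ∀ φ ∈ Set.Ioo (-Real.pi) Real.pi,
        (r * Real.cos φ, r * Real.sin φ) ∈ S ↔ φ ∈ T) →
      ((gaussianReal 0 1).prod (gaussianReal 0 1)) S =
        (∫⁻ r in Set.Ioi 0, ρ r) * volume (T ∩ Set.Ioo (-Real.pi) Real.pi) := by
    intro S T hS hT h
    rw [gaussianReal_of_var_ne_zero 0 one_ne_zero, prod_withDensity (by fun_prop) (by fun_prop),
      withDensity_apply _ hS, ← lintegral_indicator hS, ← Measure.volume_eq_prod,
      ← lintegral_comp_polarCoord_symm, polarCoord_target]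
    have hc : Set.EqOn (fun p : ℝ × ℝ => ENNReal.ofReal p.1 • S.indicator
        (fun z => gaussianPDF 0 1 z.1 * gaussianPDF 0 1 z.2) (polarCoord.symm p))
        (fun p => ρ p.1 * T.indicator 1 p.2)
        (Set.Ioi 0 ×ˢ Set.Ioo (-Real.pi) Real.pi) := by
      rintro ⟨r, φ⟩ ⟨hr, hφ⟩
      have hiff := h r hr φ hφ
      have hpdf : gaussianPDF 0 1 (r * Real.cos φ) * gaussianPDF 0 1 (r * Real.sin φ) =
          ENNReal.ofReal ((2 * Real.pi)⁻¹ * Real.exp (-r ^ 2 / 2)) := by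
        rw [gaussianPDF, gaussianPDF, ← ENNReal.ofReal_mul (gaussianPDFReal_nonneg _ _ _),
          gaussianPDFReal, gaussianPDFReal]
        congr 1
        have h2 : (√(2 * Real.pi))⁻¹ * (√(2 * Real.pi))⁻¹ = (2 * Real.pi)⁻¹ := by
          rw [← mul_inv, Real.mul_self_sqrt (by positivity)]
        simp only [NNReal.coe_one, mul_one, sub_zero]
        rw [mul_mul_mul_comm, h2, ← Real.exp_add]
        congr 2
        linear_combination (-r ^ 2 / 2) * (Real.sin_sq_add_cos_sq φ)
      simp only [polarCoord_symm_apply, smul_eq_mul]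
      by_cases hm : φ ∈ T
      · rw [Set.indicator_of_mem (hiff.2 hm), Set.indicator_of_mem hm, hpdf]
        simp [ρ]
      · rw [Set.indicator_of_notMem (fun h' => hm (hiff.1 h')), Set.indicator_of_notMem hm]
        simp
    rw [setLIntegral_congr_fun (measurableSet_Ioi.prod measurableSet_Ioo) hc,
      Measure.volume_eq_prod, ← Measure.prod_restrict,
      lintegral_prod_mul hρ.aemeasurable (measurable_one.indicator hT).aemeasurable,
      lintegral_indicator_one hT, Measure.restrict_apply hT]
  have h1 := key MeasurableSet.univ MeasurableSet.univ (by simp)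
  rw [measure_univ, Set.univ_inter, Real.volume_Ioo, sub_neg_eq_add, ← two_mul] at h1
  rw [key hS hT h, ENNReal.eq_inv_of_mul_eq_one_left h1.symm, mul_comm, div_eq_mul_inv]

lemma measurableSet_pos_and_not_pos {Ω : Type*} [MeasurableSpace Ω] {f g : Ω → ℝ}
    (hf : Measurable f) (hg : Measurable g) : MeasurableSet {ω | 0 < f ω ∧ ¬ 0 < g ω} := by
  have hf' : MeasurableSet {ω | 0 < f ω} := measurableSet_lt measurable_const hf
  have hg' : MeasurableSet {ω | 0 < g ω} := measurableSet_lt measurable_const hg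
  exact hf'.inter hg'.compl

lemma gaussianReal_prod_halfPlane_diff {θ : ℝ} (hθ : θ ∈ Set.Icc 0 Real.pi) :
    ((gaussianReal 0 1).prod (gaussianReal 0 1))
        {z | 0 < z.1 ∧ ¬ 0 < Real.cos θ * z.1 + Real.sin θ * z.2} =
      ENNReal.ofReal (θ / (2 * Real.pi)) := by
  obtain ⟨hθ0, hθπ⟩ := hθ
  have hpi := Real.pi_pos
  let T : Set ℝ := {φ | 0 < Real.cos φ ∧ ¬ 0 < Real.cos (φ - θ)}
  have hT : MeasurableSet T :=
    measurableSet_pos_and_not_pos (by fun_prop) (by fun_prop)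
  rw [gaussianReal_prod_apply_of_polar (T := T) _ hT]
  · have hvol : volume (T ∩ Set.Ioo (-Real.pi) Real.pi) = ENNReal.ofReal θ := by
      apply le_antisymm
      · have hsub : T ∩ Set.Ioo (-Real.pi) Real.pi ⊆
            Set.Ioc (-(Real.pi / 2)) (θ - Real.pi / 2) := by
          rintro φ ⟨⟨h1, h2⟩, h3, h4⟩
          have hlo : -(Real.pi / 2) < φ := by
            by_contra! hc
            have := Real.cos_nonpos_of_pi_div_two_le_of_le (x := -φ) (by linarith) (by linarith)
            rw [Real.cos_neg] at this
            linarith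
          have hhi : φ < Real.pi / 2 := by
            by_contra! hc
            have := Real.cos_nonpos_of_pi_div_two_le_of_le hc (by linarith)
            linarith
          refine ⟨hlo, ?_⟩
          by_contra! hc
          exact h2 (Real.cos_pos_of_mem_Ioo ⟨by linarith, by linarith⟩)
        refine (measure_mono hsub).trans_eq ?_
        rw [Real.volume_Ioc]
        congr 1
        ring
      · have hsub : Set.Ioo (-(Real.pi / 2)) (θ - Real.pi / 2) ⊆
            T ∩ Set.Ioo (-Real.pi) Real.pi := by
          rintro φ ⟨h1, h2⟩
          refine ⟨⟨Real.cos_pos_of_mem_Ioo ⟨h1, by linarith⟩, ?_⟩, by linarith, by linarith⟩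
          have := Real.cos_nonpos_of_pi_div_two_le_of_le (x := -(φ - θ))
            (by linarith) (by linarith)
          rw [Real.cos_neg] at this
          exact this.not_gt
        refine Eq.trans_le ?_ (measure_mono hsub)
        rw [Real.volume_Ioo]
        congr 1
        ring
    rw [hvol, ENNReal.ofReal_div_of_pos (by positivity)]
  · intro r hr φ _
    have : Real.cos θ * (r * Real.cos φ) + Real.sin θ * (r * Real.sin φ) =
        r * Real.cos (φ - θ) := by
      rw [Real.cos_sub]
      ring
    simp only [Set.mem_ofPred_eq, T, this, mul_pos_iff_of_pos_left hr]
  · exact measurableSet_pos_and_not_pos (by fun_prop) (by fun_prop)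

lemma pi_gaussianReal_halfSpace_diff {ι : Type*} [Fintype ι] {q k : ι → ℝ} {θ : ℝ}
    (hθ : θ ∈ Set.Icc 0 Real.pi) (hq : ∑ j, q j ^ 2 = 1) (hk : ∑ j, k j ^ 2 = 1)
    (hqk : ∑ j, q j * k j = Real.cos θ) :
    (Measure.pi fun _ : ι => gaussianReal 0 1)
        {a | 0 < ∑ j, a j * q j ∧ ¬ 0 < ∑ j, a j * k j} =
      ENNReal.ofReal (θ / (2 * Real.pi)) := by
  have hS : MeasurableSet {z : ℝ × ℝ | 0 < z.1 ∧ ¬ 0 < z.2} :=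
    measurableSet_pos_and_not_pos (by fun_prop) (by fun_prop)
  have h := congrArg (fun μ => μ {z : ℝ × ℝ | 0 < z.1 ∧ ¬ 0 < z.2})
    (map_pi_gaussianReal_eq_map_prod q k θ hq hk hqk)
  rw [Measure.map_apply (by fun_prop) hS, Measure.map_apply (by fun_prop) hS] at h
  exact h.trans (gaussianReal_prod_halfPlane_diff hθ)

lemma measurableSet_sign_ne {ι : Type*} [Fintype ι] (q k : ι → ℝ) :
    MeasurableSet {a : ι → ℝ | ¬ (0 < ∑ j, a j * q j ↔ 0 < ∑ j, a j * k j)} := by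
  have h : ∀ w : ι → ℝ, MeasurableSet {a : ι → ℝ | 0 < ∑ j, a j * w j} := fun w =>
    measurableSet_lt (by fun_prop) (by fun_prop)
  exact ((h q).iff (h k)).compl

lemma pi_gaussianReal_sign_ne_of_unit {ι : Type*} [Fintype ι] {q k : ι → ℝ} {θ : ℝ}
    (hθ : θ ∈ Set.Icc 0 Real.pi) (hq : ∑ j, q j ^ 2 = 1) (hk : ∑ j, k j ^ 2 = 1)
    (hqk : ∑ j, q j * k j = Real.cos θ) :
    (Measure.pi fun _ : ι => gaussianReal 0 1).real
        {a | ¬ (0 < ∑ j, a j * q j ↔ 0 < ∑ j, a j * k j)} = θ / Real.pi := by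
  have hpi := Real.pi_pos
  have hset : {a : ι → ℝ | ¬ (0 < ∑ j, a j * q j ↔ 0 < ∑ j, a j * k j)} =
      {a | 0 < ∑ j, a j * q j ∧ ¬ 0 < ∑ j, a j * k j} ∪
        {a | 0 < ∑ j, a j * k j ∧ ¬ 0 < ∑ j, a j * q j} := by
    ext a
    simp only [Set.mem_ofPred_eq, Set.mem_union]
    tauto
  have hkq : ∑ j, k j * q j = Real.cos θ := by simpa only [mul_comm] using hqk
  have h0 : 0 ≤ θ / (2 * Real.pi) := div_nonneg hθ.1 (by positivity)
  rw [measureReal_def, hset, measure_union,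
    pi_gaussianReal_halfSpace_diff hθ hq hk hqk, pi_gaussianReal_halfSpace_diff hθ hk hq hkq,
    ← ENNReal.ofReal_add h0 h0, ENNReal.toReal_ofReal (by positivity)]
  · field_simp
    ring
  · exact Set.disjoint_left.2 fun a h1 h2 => h2.2 h1.1
  · exact measurableSet_pos_and_not_pos (by fun_prop) (by fun_prop)

/-- A standard Gaussian hyperplane separates `q` and `k` with probability equal to their
cosine distance. -/
lemma pi_gaussianReal_sign_ne {C : ℕ} {q k : Fin C → ℝ} (hq : q ≠ 0) (hk : k ≠ 0) :
    (Measure.pi fun _ : Fin C => gaussianReal 0 1).real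
        {a | ¬ (0 < ∑ j, a j * q j ↔ 0 < ∑ j, a j * k j)} = cosDist q k := by
  have hpos : ∀ {w : Fin C → ℝ}, w ≠ 0 → 0 < √(∑ j, w j ^ 2) := fun {w} hw => by
    obtain ⟨j, hj⟩ := Function.ne_iff.1 hw
    exact Real.sqrt_pos.2 (Finset.sum_pos' (fun i _ => sq_nonneg _)
      ⟨j, Finset.mem_univ j, sq_pos_of_ne_zero hj⟩)
  have hunit : ∀ {w : Fin C → ℝ}, w ≠ 0 → ∑ j, (w j / √(∑ j, w j ^ 2)) ^ 2 = 1 :=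
    fun {w} hw => by
      have h := (hpos hw).ne'
      simp only [div_pow]
      rw [← Finset.sum_div, Real.sq_sqrt (Finset.sum_nonneg fun i _ => sq_nonneg _)]
      exact div_self fun h0 => h (by rw [h0, Real.sqrt_zero])
  have hsign : ∀ {w : Fin C → ℝ}, w ≠ 0 → ∀ a : Fin C → ℝ,
      0 < ∑ j, a j * (w j / √(∑ j, w j ^ 2)) ↔ 0 < ∑ j, a j * w j := fun {w} hw a => by
    simp only [← mul_div_assoc]
    rw [← Finset.sum_div, div_pos_iff_of_pos_right (hpos hw)]
  set ρ := (∑ j, q j * k j) / (√(∑ j, q j ^ 2) * √(∑ j, k j ^ 2)) with hρ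
  have habs : |ρ| ≤ 1 := by
    rw [hρ, abs_div, abs_of_pos (mul_pos (hpos hq) (hpos hk)),
      div_le_one (mul_pos (hpos hq) (hpos hk)), ← Real.sqrt_mul
        (Finset.sum_nonneg fun i _ => sq_nonneg _)]
    exact Real.abs_le_sqrt (Finset.sum_mul_sq_le_sq_mul_sq _ _ _)
  have hinner : ∑ j, (q j / √(∑ j, q j ^ 2)) * (k j / √(∑ j, k j ^ 2)) =
      Real.cos (Real.arccos ρ) := by
    rw [Real.cos_arccos (abs_le.1 habs).1 (abs_le.1 habs).2, hρ]
    simp only [div_mul_div_comm]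
    rw [← Finset.sum_div]
  have h := pi_gaussianReal_sign_ne_of_unit ⟨Real.arccos_nonneg ρ, Real.arccos_le_pi ρ⟩
    (hunit hq) (hunit hk) hinner
  simp only [hsign hq, hsign hk] at h
  rw [h, cosDist, ← hρ, one_div, div_eq_inv_mul]

/-- One-sided Hoeffding inequality for independent copies of a sub-Gaussian variable on a product
space. -/
lemma pi_real_sum_ge_le_of_hasSubgaussianMGF {Ω ι : Type*} [MeasurableSpace Ω] [Fintype ι]
    (μ : Measure Ω) [IsProbabilityMeasure μ] {Y : Ω → ℝ} {c : NNReal}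
    (hY : HasSubgaussianMGF Y c μ) {ε : ℝ} (hε : 0 ≤ ε) :
    (Measure.pi fun _ : ι => μ).real {A | ε ≤ ∑ i, Y (A i)} ≤
      Real.exp (-ε ^ 2 / (2 * (Fintype.card ι * c))) := by
  have hind : iIndepFun (fun (i : ι) (A : ι → Ω) => Y (A i)) (Measure.pi fun _ : ι => μ) :=
    iIndepFun_pi (X := fun _ => Y) fun _ => hY.aemeasurable
  have hsub : ∀ i ∈ (Finset.univ : Finset ι),
      HasSubgaussianMGF (fun A : ι → Ω => Y (A i)) c (Measure.pi fun _ : ι => μ) := by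
    intro i _
    have hmp := measurePreserving_eval (fun _ : ι => μ) i
    exact HasSubgaussianMGF.of_map hmp.measurable.aemeasurable (by rwa [hmp.map_eq])
  simpa using HasSubgaussianMGF.measure_sum_ge_le_of_iIndepFun hind hsub hε

/-- Hoeffding's inequality for the empirical frequency of an event. -/
lemma pi_abs_average_indicator_sub_le {Ω : Type*} [MeasurableSpace Ω] {D : ℕ} (hD : 0 < D)
    (μ : Measure Ω) [IsProbabilityMeasure μ] {B : Set Ω} (hB : MeasurableSet B) {δ : ℝ}
    (hδ : 0 ≤ δ) :
    ENNReal.ofReal (1 - 2 * Real.exp (-(2 * δ ^ 2 * D))) ≤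
      (Measure.pi fun _ : Fin D => μ)
        {A | |(1 / (D : ℝ)) * ∑ i, B.indicator (1 : Ω → ℝ) (A i) - μ.real B| ≤ δ} := by
  have hD' : (0 : ℝ) < D := Nat.cast_pos.2 hD
  let P := Measure.pi fun _ : Fin D => μ
  let Y : Ω → ℝ := fun ω => B.indicator (1 : Ω → ℝ) ω - μ.real B
  have hYm : Measurable Y := (measurable_one.indicator hB).sub_const _
  have hY : HasSubgaussianMGF Y ((‖(1 : ℝ) - 0‖₊ / 2) ^ 2) μ := by
    have h := hasSubgaussianMGF_of_mem_Icc (μ := μ) (X := B.indicator (1 : Ω → ℝ)) (a := 0)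
      (b := 1) (measurable_one.indicator hB).aemeasurable (ae_of_all _ fun ω => by
        by_cases hω : ω ∈ B <;> simp [hω])
    rwa [integral_indicator_one hB] at h
  have hexp : Real.exp (-(D * δ) ^ 2 /
      (2 * (Fintype.card (Fin D) * (((‖(1 : ℝ) - 0‖₊ / 2) ^ 2 : NNReal) : ℝ)))) =
        Real.exp (-(2 * δ ^ 2 * D)) := by
    congr 1
    simp
    field_simp
  have h1 := pi_real_sum_ge_le_of_hasSubgaussianMGF (ι := Fin D) μ hY (mul_nonneg hD'.le hδ)
  have h2 := pi_real_sum_ge_le_of_hasSubgaussianMGF (ι := Fin D) μ hY.neg (mul_nonneg hD'.le hδ)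
  rw [hexp] at h1 h2
  set G : Set (Fin D → Ω) :=
    {A | |(1 / (D : ℝ)) * ∑ i, B.indicator (1 : Ω → ℝ) (A i) - μ.real B| ≤ δ} with hG
  have hGm : MeasurableSet G := by
    have hm : Measurable (B.indicator (1 : Ω → ℝ)) := measurable_one.indicator hB
    exact measurableSet_le (by fun_prop) (by fun_prop)
  have hsub : Gᶜ ⊆ {A | D * δ ≤ ∑ i, Y (A i)} ∪ {A | D * δ ≤ ∑ i, (-Y) (A i)} := by
    intro A hA
    have hA' : δ < |(1 / (D : ℝ)) * ∑ i, B.indicator (1 : Ω → ℝ) (A i) - μ.real B| := by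
      simpa [hG] using hA
    have hs : (1 / (D : ℝ)) * ∑ i, B.indicator (1 : Ω → ℝ) (A i) - μ.real B =
        (∑ i, Y (A i)) / D := by
      simp only [Y, Finset.sum_sub_distrib, Finset.sum_const, Finset.card_univ, Fintype.card_fin,
        nsmul_eq_mul]
      field_simp
    rw [hs, lt_abs, ← neg_div, lt_div_iff₀' hD', lt_div_iff₀' hD'] at hA'
    refine hA'.imp (fun h => h.le) fun h => ?_
    simpa using h.le
  have hcompl : P.real Gᶜ ≤ 2 * Real.exp (-(2 * δ ^ 2 * D)) :=
    calc P.real Gᶜ ≤ _ := measureReal_mono hsub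
      _ ≤ _ := measureReal_union_le _ _
      _ ≤ _ := (add_le_add h1 h2).trans_eq (two_mul _).symm
  rw [probReal_compl_eq_one_sub hGm] at hcompl
  rw [ENNReal.ofReal_le_iff_le_toReal (measure_ne_top _ _), ← measureReal_def]
  linarith

lemma normHamDist_binEmbed {C D : ℕ} (A : Fin D → Fin C → ℝ) (q k : Fin C → ℝ) :
    normHamDist (binEmbed A q) (binEmbed A k) =
      (1 / (D : ℝ)) * ∑ i, Set.indicator
        {a : Fin C → ℝ | ¬ (0 < ∑ j, a j * q j ↔ 0 < ∑ j, a j * k j)} 1 (A i) := by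
  classical
  rw [normHamDist, Finset.card_filter, Nat.cast_sum]
  congr 1
  refine Finset.sum_congr rfl fun i _ => ?_
  by_cases hq : 0 < ∑ j, A i j * q j <;> by_cases hk : 0 < ∑ j, A i j * k j <;>
    simp [binEmbed, hq, hk]

theorem stmt_1 (C D : ℕ) (hC : 0 < C) (hD : 0 < D)
    (q k : Fin C → ℝ) (hq : q ≠ 0) (hk : k ≠ 0) (δ : ℝ) (hδ : 0 < δ) :
    (Measure.pi fun _ : Fin D => Measure.pi fun _ : Fin C => gaussianReal 0 1)
        {A : Fin D → Fin C → ℝ |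
          |normHamDist (binEmbed A q) (binEmbed A k) - cosDist q k| ≤ δ}
      ≥ ENNReal.ofReal (1 - 2 * Real.exp (-δ ^ 2 * D)) := by
  simp only [normHamDist_binEmbed, ← pi_gaussianReal_sign_ne hq hk]
  refine le_trans (ENNReal.ofReal_le_ofReal ?_)
    (pi_abs_average_indicator_sub_le hD _ (measurableSet_sign_ne q k) hδ.le)
  gcongr
  have : 0 ≤ δ ^ 2 * D := by positivity
  linarith
end

section
/- Let C be a positive natural number and let q, k : Fin C → ℝ be nonzero vectors. Let a : Fin C → ℝ be a random vector distributed according to the product measure ⨂_{j ∈ Fin C} N(0,1) of standard Gaussians. Then the probability, with respect to the law of a, of the event { (∑_j a j * q j > 0) ≠ (∑_j a j * k j > 0) } equals (1/π)·Real.arccos(f_C(q, k)). -/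
open MeasureTheory ProbabilityTheory

/-- The characteristic function of a pair of linear functionals of a standard Gaussian vector
depends only on the Gram matrix of the functionals. -/
lemma charFunDual_map_pi_gaussianReal {ι : Type*} [Fintype ι] (u w : ι → ℝ)
    (L : StrongDual ℝ (ℝ × ℝ)) :
    charFunDual ((Measure.pi fun _ : ι => gaussianReal 0 1).map
        fun a => (∑ i, a i * u i, ∑ i, a i * w i)) L
      = Complex.exp (-((L (1, 0) ^ 2 * ∑ i, u i ^ 2 + 2 * L (1, 0) * L (0, 1) * ∑ i, u i * w i
          + L (0, 1) ^ 2 * ∑ i, w i ^ 2 : ℝ) : ℂ) / 2) := by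
  have hL (a : ι → ℝ) : L (∑ i, a i * u i, ∑ i, a i * w i)
      = ∑ i, (L (1, 0) * u i + L (0, 1) * w i) * a i := by
    have : ((∑ i, a i * u i, ∑ i, a i * w i) : ℝ × ℝ)
        = (∑ i, a i * u i) • (1, 0) + (∑ i, a i * w i) • (0, 1) := by simp
    rw [this, map_add, map_smul, map_smul, smul_eq_mul, smul_eq_mul, Finset.sum_mul,
      Finset.sum_mul, ← Finset.sum_add_distrib]
    exact Finset.sum_congr rfl fun i _ => by ring
  rw [charFunDual_apply, integral_map (Measurable.aemeasurable (by fun_prop))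
    (Measurable.aestronglyMeasurable (by fun_prop))]
  simp_rw [hL, Complex.ofReal_sum, Finset.sum_mul, Complex.exp_sum]
  rw [integral_fintype_prod_eq_prod (f := fun i (x : ℝ) =>
    Complex.exp (((L (1, 0) * u i + L (0, 1) * w i) * x : ℝ) * Complex.I))]
  simp_rw [Complex.ofReal_mul, ← charFun_apply_real, charFun_gaussianReal, ← Complex.exp_sum]
  congr 1
  push_cast
  simp only [Finset.mul_sum, ← Finset.sum_add_distrib, Finset.sum_div, ← Finset.sum_neg_distrib]
  refine Finset.sum_congr rfl fun i _ => ?_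
  ring

/-- The joint law of two linear functionals of a standard Gaussian vector depends only on the Gram
matrix of the functionals. -/
lemma map_pi_gaussianReal_eq_of_gram_eq {ι κ : Type*} [Fintype ι] [Fintype κ]
    {u w : ι → ℝ} {u' w' : κ → ℝ} (huu : ∑ i, u i ^ 2 = ∑ i, u' i ^ 2)
    (huw : ∑ i, u i * w i = ∑ i, u' i * w' i) (hww : ∑ i, w i ^ 2 = ∑ i, w' i ^ 2) :
    (Measure.pi fun _ : ι => gaussianReal 0 1).map
        (fun a => (∑ i, a i * u i, ∑ i, a i * w i))
      = (Measure.pi fun _ : κ => gaussianReal 0 1).map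
        (fun a => (∑ i, a i * u' i, ∑ i, a i * w' i)) := by
  have := Measure.isProbabilityMeasure_map (μ := Measure.pi fun _ : ι => gaussianReal 0 1)
    (f := fun a => (∑ i, a i * u i, ∑ i, a i * w i)) (Measurable.aemeasurable (by fun_prop))
  have := Measure.isProbabilityMeasure_map (μ := Measure.pi fun _ : κ => gaussianReal 0 1)
    (f := fun a => (∑ i, a i * u' i, ∑ i, a i * w' i)) (Measurable.aemeasurable (by fun_prop))
  apply Measure.ext_of_charFunDual
  ext L
  rw [charFunDual_map_pi_gaussianReal, charFunDual_map_pi_gaussianReal, huu, huw, hww]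

lemma integral_Ioi_mul_exp_neg_sq_div_two :
    ∫ r in Set.Ioi (0 : ℝ), r * Real.exp (-r ^ 2 / 2) = 1 := by
  have h := integral_mul_cexp_neg_mul_sq (b := ((1 / 2 : ℝ) : ℂ)) (by norm_num)
  have h' : ∫ r in Set.Ioi (0 : ℝ), (r : ℂ) * Complex.exp (-((1 / 2 : ℝ) : ℂ) * (r : ℂ) ^ 2)
      = ((∫ r in Set.Ioi (0 : ℝ), r * Real.exp (-r ^ 2 / 2) : ℝ) : ℂ) := by
    rw [← integral_complex_ofReal]
    refine integral_congr_ae (ae_of_all _ fun r => ?_)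
    push_cast
    ring_nf
  rw [h'] at h
  norm_num at h
  exact_mod_cast h

lemma lintegral_Ioi_ofReal_mul_exp_neg_sq_div_two :
    ∫⁻ r in Set.Ioi (0 : ℝ), ENNReal.ofReal (r * Real.exp (-r ^ 2 / 2)) = 1 := by
  rw [← ofReal_integral_eq_lintegral_ofReal, integral_Ioi_mul_exp_neg_sq_div_two,
    ENNReal.ofReal_one]
  · refine ((integrable_mul_exp_neg_mul_sq (b := 1 / 2) (by norm_num)).congr
      (ae_of_all _ fun r => ?_)).integrableOn
    ring_nf
  · filter_upwards [self_mem_ae_restrict measurableSet_Ioi] with r hr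
    have : (0 : ℝ) < r := hr
    positivity

/-- The standard Gaussian measure of a planar cone is its normalized angular measure. -/
lemma gaussianReal_prod_gaussianReal_apply_cone {S : Set (ℝ × ℝ)} (hS : MeasurableSet S)
    (hcone : ∀ r : ℝ, 0 < r → ∀ p : ℝ × ℝ, r • p ∈ S ↔ p ∈ S) :
    ((gaussianReal 0 1).prod (gaussianReal 0 1)) S
      = ENNReal.ofReal (1 / (2 * Real.pi))
        * volume ({φ : ℝ | (Real.cos φ, Real.sin φ) ∈ S} ∩ Set.Ioo (-Real.pi) Real.pi) := by
  have hT : MeasurableSet {φ : ℝ | (Real.cos φ, Real.sin φ) ∈ S} :=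
    hS.preimage (f := fun φ : ℝ => (Real.cos φ, Real.sin φ)) (by fun_prop)
  rw [gaussianReal_of_var_ne_zero 0 one_ne_zero,
    prod_withDensity (measurable_gaussianPDF _ _) (measurable_gaussianPDF _ _),
    withDensity_apply _ hS, ← lintegral_indicator hS, ← Measure.volume_eq_prod,
    ← lintegral_comp_polarCoord_symm]
  calc
    _ = ∫⁻ p in Set.Ioi (0 : ℝ) ×ˢ Set.Ioo (-Real.pi) Real.pi,
          ENNReal.ofReal (p.1 * Real.exp (-p.1 ^ 2 / 2))
            * {φ : ℝ | (Real.cos φ, Real.sin φ) ∈ S}.indicator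
              (fun _ => ENNReal.ofReal (1 / (2 * Real.pi))) p.2 := by
      refine setLIntegral_congr_fun (measurableSet_Ioi.prod measurableSet_Ioo) fun p hp => ?_
      obtain ⟨r, φ⟩ := p
      have hr : 0 < r := hp.1
      have hmem : (r * Real.cos φ, r * Real.sin φ) ∈ S ↔ (Real.cos φ, Real.sin φ) ∈ S :=
        hcone r hr (Real.cos φ, Real.sin φ)
      simp only [polarCoord_symm_apply, smul_eq_mul]
      by_cases h : (Real.cos φ, Real.sin φ) ∈ S
      · rw [Set.indicator_of_mem (hmem.2 h),
          Set.indicator_of_mem (s := {φ : ℝ | (Real.cos φ, Real.sin φ) ∈ S}) h]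
        simp only [gaussianPDF]
        rw [← ENNReal.ofReal_mul (gaussianPDFReal_nonneg _ _ _), ← ENNReal.ofReal_mul hr.le,
          ← ENNReal.ofReal_mul (by positivity)]
        congr 1
        have hexp : Real.exp (-r ^ 2 / 2) = Real.exp (-(r * Real.cos φ) ^ 2 / 2)
            * Real.exp (-(r * Real.sin φ) ^ 2 / 2) := by
          rw [← Real.exp_add]
          congr 1
          linear_combination (r ^ 2 / 2) * Real.sin_sq_add_cos_sq φ
        have hsqrt : (√(2 * Real.pi))⁻¹ * (√(2 * Real.pi))⁻¹ = 1 / (2 * Real.pi) := by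
          rw [← mul_inv, Real.mul_self_sqrt (by positivity), one_div]
        simp only [gaussianPDFReal, sub_zero, NNReal.coe_one, mul_one]
        rw [hexp, ← hsqrt]
        ring
      · rw [Set.indicator_of_notMem (fun h' => h (hmem.1 h')),
          Set.indicator_of_notMem (s := {φ : ℝ | (Real.cos φ, Real.sin φ) ∈ S}) h, mul_zero, mul_zero]
    _ = _ := by
      rw [Measure.volume_eq_prod, ← Measure.prod_restrict,
        lintegral_prod_mul (f := fun r : ℝ => ENNReal.ofReal (r * Real.exp (-r ^ 2 / 2)))
          (Measurable.aemeasurable (by fun_prop))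
          ((measurable_const.indicator hT).aemeasurable),
        lintegral_Ioi_ofReal_mul_exp_neg_sq_div_two, one_mul, lintegral_indicator_const hT,
        Measure.restrict_apply hT]

lemma cos_pos_iff_abs_lt_pi_div_two {x : ℝ} (hx : |x| ≤ 3 * Real.pi / 2) :
    0 < Real.cos x ↔ |x| < Real.pi / 2 := by
  rw [← Real.cos_abs]
  refine ⟨fun h => ?_, fun h => Real.cos_pos_of_mem_Ioo ⟨by linarith [abs_nonneg x], h⟩⟩
  by_contra! h'
  exact h.not_ge (Real.cos_nonpos_of_pi_div_two_le_of_le h' (by linarith))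

/-- The total angle of the directions on which the signs of two linear functionals at angle `2 * h`
differ is `4 * h`. -/
lemma volume_cos_pos_ne_cos_pos {h : ℝ} (h0 : 0 ≤ h) (h1 : h ≤ Real.pi / 2) :
    volume ({φ : ℝ | (0 < Real.cos (φ - h)) ≠ (0 < Real.cos (φ + h))}
        ∩ Set.Ioo (-Real.pi) Real.pi) = ENNReal.ofReal (4 * h) := by
  have hset : {φ : ℝ | (0 < Real.cos (φ - h)) ≠ (0 < Real.cos (φ + h))}
        ∩ Set.Ioo (-Real.pi) Real.pi
      = (Set.Ioo (h - Real.pi / 2) (h + Real.pi / 2)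
          \ Set.Ioo (h - Real.pi / 2) (Real.pi / 2 - h))
        ∪ (Set.Ioo (-h - Real.pi / 2) (Real.pi / 2 - h)
          \ Set.Ioo (h - Real.pi / 2) (Real.pi / 2 - h)) := by
    ext φ
    simp only [Set.mem_inter_iff, Set.mem_ofPred_eq, Set.mem_union, Set.mem_sdiff, Set.mem_Ioo,
      ne_eq, eq_iff_iff]
    by_cases hφ : -Real.pi < φ ∧ φ < Real.pi
    · obtain ⟨ha, hb⟩ := hφ
      rw [cos_pos_iff_abs_lt_pi_div_two (abs_le.2 ⟨by linarith, by linarith⟩),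
        cos_pos_iff_abs_lt_pi_div_two (abs_le.2 ⟨by linarith, by linarith⟩), abs_lt, abs_lt]
      grind
    · grind
  rw [hset, measure_union _ (measurableSet_Ioo.diff measurableSet_Ioo),
    measure_sdiff (Set.Ioo_subset_Ioo_right (by linarith)) nullMeasurableSet_Ioo (by simp),
    measure_sdiff (Set.Ioo_subset_Ioo_left (by linarith)) nullMeasurableSet_Ioo (by simp),
    Real.volume_Ioo, Real.volume_Ioo, Real.volume_Ioo,
    ← ENNReal.ofReal_sub _ (by linarith), ← ENNReal.ofReal_sub _ (by linarith),
    ← ENNReal.ofReal_add (by linarith) (by linarith)]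
  · congr 1
    ring
  · rw [Set.disjoint_left]
    simp only [Set.mem_sdiff, Set.mem_Ioo]
    grind

/-- Two functionals at angle `2 * h` of a planar standard Gaussian vector have different signs with
probability `2 * h / π`. -/
lemma gaussianReal_prod_gaussianReal_sign_ne {h : ℝ} (h0 : 0 ≤ h) (h1 : h ≤ Real.pi / 2) :
    ((gaussianReal 0 1).prod (gaussianReal 0 1))
        {p : ℝ × ℝ | (0 < p.1 * Real.cos h + p.2 * Real.sin h)
          ≠ (0 < p.1 * Real.cos h + p.2 * -Real.sin h)}
      = ENNReal.ofReal ((1 / Real.pi) * (2 * h)) := by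
  rw [gaussianReal_prod_gaussianReal_apply_cone]
  · have hset : {φ : ℝ | (Real.cos φ, Real.sin φ) ∈
          {p : ℝ × ℝ | (0 < p.1 * Real.cos h + p.2 * Real.sin h)
            ≠ (0 < p.1 * Real.cos h + p.2 * -Real.sin h)}}
        = {φ : ℝ | (0 < Real.cos (φ - h)) ≠ (0 < Real.cos (φ + h))} := by
      ext φ
      simp only [Set.mem_ofPred_eq, Real.cos_sub, Real.cos_add, mul_neg, ← sub_eq_add_neg]
    rw [hset, volume_cos_pos_ne_cos_pos h0 h1, ← ENNReal.ofReal_mul (by positivity)]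
    congr 1
    field_simp
    ring
  · simp only [ne_eq, eq_iff_iff]
    measurability
  · intro r hr p
    have hmul (c d : ℝ) : (0 < (r • p).1 * c + (r • p).2 * d) ↔ 0 < p.1 * c + p.2 * d := by
      rw [← mul_pos_iff_of_pos_left (b := p.1 * c + p.2 * d) hr]
      simp only [Prod.smul_fst, Prod.smul_snd, smul_eq_mul]
      ring_nf
    simp only [Set.mem_ofPred_eq, hmul]

lemma cosSim_mem_Icc {C : ℕ} (x y : Fin C → ℝ) : cosSim x y ∈ Set.Icc (-1) 1 := by
  have h : |∑ j, x j * y j| ≤ √(∑ j, x j ^ 2) * √(∑ j, y j ^ 2) := by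
    rw [← Real.sqrt_mul (by positivity)]
    exact Real.abs_le_sqrt (Finset.sum_mul_sq_le_sq_mul_sq _ _ _)
  rw [Set.mem_Icc, ← abs_le, cosSim, abs_div, abs_of_nonneg (a := _ * _) (by positivity)]
  exact div_le_one_of_le₀ h (by positivity)

lemma sqrt_sum_sq_pos {ι : Type*} [Fintype ι] {x : ι → ℝ} (hx : x ≠ 0) :
    0 < √(∑ j, x j ^ 2) := by
  obtain ⟨i, hi⟩ := Function.ne_iff.1 hx
  exact Real.sqrt_pos.2 (Finset.sum_pos' (fun j _ => sq_nonneg (x j))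
    ⟨i, Finset.mem_univ i, by have : x i ≠ 0 := hi; positivity⟩)

lemma sum_div_sqrt_sum_sq_sq {ι : Type*} [Fintype ι] {x : ι → ℝ} (hx : x ≠ 0) :
    ∑ i, (x i / √(∑ j, x j ^ 2)) ^ 2 = 1 := by
  have h := sqrt_sum_sq_pos hx
  simp_rw [div_pow, ← Finset.sum_div]
  rw [Real.sq_sqrt (by positivity), div_self (Real.sqrt_pos.1 h).ne']

theorem stmt_2 (C : ℕ) (hC : 0 < C) (q k : Fin C → ℝ) (hq : q ≠ 0) (hk : k ≠ 0) :
    (Measure.pi fun _ : Fin C => gaussianReal 0 1)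
        {a : Fin C → ℝ | (0 < ∑ j, a j * q j) ≠ (0 < ∑ j, a j * k j)}
      = ENNReal.ofReal ((1 / Real.pi) * Real.arccos (cosSim q k)) := by
  set h := Real.arccos (cosSim q k) / 2 with hh
  have h0 : 0 ≤ h := div_nonneg (Real.arccos_nonneg _) zero_le_two
  have h1 : h ≤ Real.pi / 2 := div_le_div_of_nonneg_right (Real.arccos_le_pi _) zero_le_two
  have hcos : Real.cos h ^ 2 - Real.sin h ^ 2 = cosSim q k := by
    rw [← Real.cos_two_mul', hh, mul_div_cancel₀ _ two_ne_zero,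
      Real.cos_arccos (cosSim_mem_Icc q k).1 (cosSim_mem_Icc q k).2]
  have hs := sqrt_sum_sq_pos hq
  have ht := sqrt_sum_sq_pos hk
  have hlaw := map_pi_gaussianReal_eq_of_gram_eq
    (u := fun i => q i / √(∑ j, q j ^ 2)) (w := fun i => k i / √(∑ j, k j ^ 2))
    (u' := ![Real.cos h, Real.sin h]) (w' := ![Real.cos h, -Real.sin h])
    (by simp [sum_div_sqrt_sum_sq_sq hq])
    (by
      simp only [Fin.sum_univ_two, Matrix.cons_val_zero, Matrix.cons_val_one]
      simp_rw [div_mul_div_comm, ← Finset.sum_div]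
      change cosSim q k = _
      rw [← hcos]
      ring)
    (by simp [sum_div_sqrt_sum_sq_sq hk])
  have hS : MeasurableSet {p : ℝ × ℝ | (0 < p.1) ≠ (0 < p.2)} := by
    simp only [ne_eq, eq_iff_iff]
    measurability
  have hleft : {a : Fin C → ℝ | (0 < ∑ j, a j * q j) ≠ (0 < ∑ j, a j * k j)}
      = (fun a : Fin C → ℝ => (∑ i, a i * (q i / √(∑ j, q j ^ 2)),
          ∑ i, a i * (k i / √(∑ j, k j ^ 2)))) ⁻¹' {p : ℝ × ℝ | (0 < p.1) ≠ (0 < p.2)} := by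
    ext a
    simp only [Set.mem_ofPred_eq, Set.mem_preimage, ← mul_div_assoc, ← Finset.sum_div,
      div_pos_iff_of_pos_right hs, div_pos_iff_of_pos_right ht]
  rw [hleft, ← Measure.map_apply (by fun_prop) hS, hlaw, Measure.map_apply (by fun_prop) hS]
  have hprod := (measurePreserving_finTwoArrow (gaussianReal 0 1)).measure_preimage_equiv
    {p : ℝ × ℝ | (0 < p.1 * Real.cos h + p.2 * Real.sin h)
      ≠ (0 < p.1 * Real.cos h + p.2 * -Real.sin h)}
  rw [gaussianReal_prod_gaussianReal_sign_ne h0 h1, hh, mul_div_cancel₀ _ two_ne_zero] at hprod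
  rw [← hprod]
  congr 1
  ext a
  simp [Fin.sum_univ_two, hh]
end
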